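/- Let G be a minimally imperfect graph with a skew partition A, B, C, D, let ω = ω(G), and let G1 and G2 be the subgraphs of G induced by A ∪ B ∪ C and by A ∪ B ∪ D respectively. Then for any proper ω-coloring C1 of G1 and any proper ω-coloring C2 of G2, the number of colors that C1 uses on A is different from the number of colors that C2 uses on A. -/

import Mathlib

open SimpleGraph

/-- A graph is perfect if, in every induced subgraph, the clique number equals
the chromatic number. -/
def IsPerfect {V : Type*} (G : SimpleGraph V) : Prop :=
  ∀ S : Set V, ((G.induce S).cliqueNum : ℕ∞) = (G.induce S).chromaticNumber

/-- A graph is minimally imperfect if it is not perfect but every proper induced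
subgraph of it is perfect. -/
def MinimallyImperfect {V : Type*} (G : SimpleGraph V) : Prop :=
  ¬ IsPerfect G ∧ ∀ S : Set V, S ≠ Set.univ → IsPerfect (G.induce S)

/-- `A, B, C, D` form a skew partition of `G`: all four sets are nonempty, they
partition the vertex set, every vertex of `A` is adjacent to every vertex of `B`,
and there are no edges between `C` and `D`. -/
def IsSkewPartition {V : Type*} (G : SimpleGraph V) (A B C D : Set V) : Prop :=
  A.Nonempty ∧ B.Nonempty ∧ C.Nonempty ∧ D.Nonempty ∧
  A ∪ B ∪ C ∪ D = Set.univ ∧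
  Disjoint A B ∧ Disjoint A C ∧ Disjoint A D ∧
  Disjoint B C ∧ Disjoint B D ∧ Disjoint C D ∧
  (∀ a ∈ A, ∀ b ∈ B, G.Adj a b) ∧
  (∀ c ∈ C, ∀ d ∈ D, ¬ G.Adj c d)

/-- A graph has a skew partition if its vertex set admits one. -/
def HasSkewPartition {V : Type*} (G : SimpleGraph V) : Prop :=
  ∃ A B C D : Set V, IsSkewPartition G A B C D

namespace SimpleGraph

variable {V W : Type*} {G : SimpleGraph V}

theorem cliqueNum_le_of_embedding [Finite W] {H : SimpleGraph W} (f : G ↪g H) :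
    G.cliqueNum ≤ H.cliqueNum := by
  obtain ⟨s, hs⟩ := G.exists_isNClique_cliqueNum
  have hc : H.IsClique (s.map f.toEmbedding : Finset W) := by
    intro x hx y hy hxy
    simp only [Finset.coe_map, Set.mem_image] at hx hy
    obtain ⟨a, ha, rfl⟩ := hx
    obtain ⟨b, hb, rfl⟩ := hy
    exact f.map_adj_iff.2 (hs.isClique ha hb fun h => hxy (h ▸ rfl))
  rw [← hs.card_eq, ← s.card_map f.toEmbedding]
  exact hc.card_le_cliqueNum

theorem colorable_cliqueNum_of_isPerfect [Finite V] (h : IsPerfect G) :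
    G.Colorable G.cliqueNum := by
  have hc : (G.induce Set.univ).Colorable (G.induce Set.univ).cliqueNum :=
    chromaticNumber_le_iff_colorable.1 (h Set.univ).ge
  exact (hc.mono (cliqueNum_le_of_embedding G.induceUnivIso.toEmbedding)).of_hom
    G.induceUnivIso.symm.toHom

theorem isPerfect_of_forall_colorable_cliqueNum
    (h : ∀ S : Set V, (G.induce S).Colorable (G.induce S).cliqueNum) : IsPerfect G :=
  fun S => le_antisymm cliqueNum_le_chromaticNumber (chromaticNumber_le_iff_colorable.2 (h S))

theorem not_colorable_cliqueNum_of_minimallyImperfect [Finite V] (h : MinimallyImperfect G) :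
    ¬ G.Colorable G.cliqueNum := by
  refine fun hc => h.1 (isPerfect_of_forall_colorable_cliqueNum fun S => ?_)
  by_cases hS : S = Set.univ
  · subst hS
    exact (hc.mono (cliqueNum_le_of_embedding G.induceUnivIso.symm.toEmbedding)).of_hom
      G.induceUnivIso.toHom
  · exact colorable_cliqueNum_of_isPerfect (h.2 S hS)

theorem colorable_induce_of_minimallyImperfect [Finite V] (h : MinimallyImperfect G)
    {S : Set V} (hS : S ≠ Set.univ) {k : ℕ}
    (hk : ∀ s : Finset V, ↑s ⊆ S → G.IsClique s → s.card ≤ k) : (G.induce S).Colorable k := by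
  refine (colorable_cliqueNum_of_isPerfect (h.2 S hS)).mono ?_
  obtain ⟨s, hs⟩ := (G.induce S).exists_isNClique_cliqueNum
  rw [← hs.card_eq, ← s.card_map (Function.Embedding.subtype _)]
  refine hk _ (by simp) ?_
  intro x hx y hy hxy
  simp only [Finset.coe_map, Set.mem_image] at hx hy
  obtain ⟨a, ha, rfl⟩ := hx
  obtain ⟨b, hb, rfl⟩ := hy
  exact hs.isClique ha hb fun h => hxy (h ▸ rfl)

theorem Colorable.of_induce_compl {S : Set V} {m n : ℕ} (hm : (G.induce S).Colorable m)
    (hn : (G.induce Sᶜ).Colorable n) : G.Colorable (m + n) := by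
  classical
  obtain ⟨f⟩ := hm
  obtain ⟨g⟩ := hn
  have c : G.Coloring (Fin m ⊕ Fin n) :=
    Coloring.mk (fun v => if h : v ∈ S then .inl (f ⟨v, h⟩) else .inr (g ⟨v, h⟩)) <| by
      intro v w hvw
      by_cases hv : v ∈ S <;> by_cases hw : w ∈ S <;> simp only [hv, hw, dite_true, dite_false]
      · exact fun h => f.valid (v := ⟨v, hv⟩) (w := ⟨w, hw⟩) hvw (Sum.inl_injective h)
      · simp
      · simp
      · exact fun h => g.valid (v := ⟨v, hv⟩) (w := ⟨w, hw⟩) hvw (Sum.inr_injective h)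
  simpa using c.colorable

theorem IsClique.card_le_ncard_of_coloring_induce {α : Type*} [Finite α] {T : Set V}
    (c : (G.induce T).Coloring α) {s : Finset V} (hs : G.IsClique s) (hsT : ↑s ⊆ T)
    {F : Set α} (hF : ∀ x (hx : x ∈ s), c ⟨x, hsT hx⟩ ∈ F) : s.card ≤ F.ncard := by
  rw [← s.card_attach, ← Set.ncard_coe_finset]
  refine Set.ncard_le_ncard_of_injOn (fun x => c ⟨x, hsT x.2⟩) (fun x _ => hF x x.2) ?_
    F.toFinite
  intro x _ y _ hxy
  by_contra hne
  exact c.valid (v := ⟨x, hsT x.2⟩) (w := ⟨y, hsT y.2⟩)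
    (hs x.2 y.2 fun h => hne (Subtype.ext h)) hxy

theorem IsClique.subset_or_subset_of_forall_not_adj {s P C D : Set V} (hs : G.IsClique s)
    (hcover : P ∪ C ∪ D = Set.univ) (hdisj : Disjoint C D)
    (hCD : ∀ c ∈ C, ∀ d ∈ D, ¬ G.Adj c d) : s ⊆ P ∪ C ∨ s ⊆ P ∪ D := by
  by_contra! h
  simp only [Set.not_subset] at h
  obtain ⟨⟨x, hx, hxC⟩, y, hy, hyD⟩ := h
  have hx' : x ∈ P ∪ C ∪ D := hcover ▸ Set.mem_univ x
  have hy' : y ∈ P ∪ C ∪ D := hcover ▸ Set.mem_univ y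
  have hxD : x ∈ D := hx'.resolve_left hxC
  have hyC : y ∈ C := by
    rcases hy' with (h | h) | h
    exacts [(hyD (.inl h)).elim, h, (hyD (.inr h)).elim]
  exact hCD y hyC x hxD (hs hy hx fun h => hdisj.ne_of_mem hyC hxD h)

/-- A colouring of `T` uses on a set `A` no colour it uses on a vertex complete to `A`. -/
theorem Coloring.notMem_colors_of_forall_adj {α : Type*} {T A : Set V}
    (c : (G.induce T).Coloring α) {b : T} (hb : ∀ a ∈ A, G.Adj a b) :
    c b ∉ {i | ∃ x : T, (x : V) ∈ A ∧ c x = i} := by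
  rintro ⟨a, ha, h⟩
  exact c.valid (v := a) (w := b) (hb a ha) h

end SimpleGraph

/-- Let `G` be minimally imperfect with skew partition `A, B, C, D`, let
`ω = ω(G)`, and let `G₁`, `G₂` be the subgraphs induced by `A ∪ B ∪ C` and
`A ∪ B ∪ D`. Then any proper `ω`-colorings of `G₁` and `G₂` use different numbers
of colors on `A`. -/
theorem colorings_differ_on_A {V : Type*} [Fintype V] (G : SimpleGraph V)
    (A B C D : Set V) (hmi : MinimallyImperfect G)
    (hsp : IsSkewPartition G A B C D)
    (C1 : (G.induce (A ∪ B ∪ C)).Coloring (Fin G.cliqueNum))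
    (C2 : (G.induce (A ∪ B ∪ D)).Coloring (Fin G.cliqueNum)) :
    {c : Fin G.cliqueNum | ∃ x : ↑(A ∪ B ∪ C), (x : V) ∈ A ∧ C1 x = c}.ncard ≠
      {c : Fin G.cliqueNum | ∃ x : ↑(A ∪ B ∪ D), (x : V) ∈ A ∧ C2 x = c}.ncard := by
  obtain ⟨⟨a, ha⟩, ⟨b, hb⟩, -, -, hcover, -, hAC, hAD, hBC, hBD, hCD, hAB, hnadj⟩ := hsp
  intro heq
  set F₁ := {c : Fin G.cliqueNum | ∃ x : ↑(A ∪ B ∪ C), (x : V) ∈ A ∧ C1 x = c}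
  set F₂ := {c : Fin G.cliqueNum | ∃ x : ↑(A ∪ B ∪ D), (x : V) ∈ A ∧ C2 x = c}
  let X : Set V := {v | (∃ h, C1 ⟨v, h⟩ ∈ F₁) ∨ ∃ h, C2 ⟨v, h⟩ ∈ F₂}
  have hX₁ : ∀ v (h : v ∈ A ∪ B ∪ C), v ∈ X ↔ C1 ⟨v, h⟩ ∈ F₁ := by
    refine fun v h => ⟨?_, fun hv => .inl ⟨h, hv⟩⟩
    rintro (⟨_, hv⟩ | ⟨(h' | h') | h', hv⟩)
    · exact hv
    · exact ⟨⟨v, h⟩, h', rfl⟩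
    · exact (C2.notMem_colors_of_forall_adj (fun a ha => hAB a ha v h') hv).elim
    · rcases h with (h | h) | h
      exacts [(hAD.ne_of_mem h h' rfl).elim, (hBD.ne_of_mem h h' rfl).elim,
        (hCD.ne_of_mem h h' rfl).elim]
  have hX₂ : ∀ v (h : v ∈ A ∪ B ∪ D), v ∈ X ↔ C2 ⟨v, h⟩ ∈ F₂ := by
    refine fun v h => ⟨?_, fun hv => .inr ⟨h, hv⟩⟩
    rintro (⟨(h' | h') | h', hv⟩ | ⟨_, hv⟩)
    · exact ⟨⟨v, h⟩, h', rfl⟩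
    · exact (C1.notMem_colors_of_forall_adj (fun a ha => hAB a ha v h') hv).elim
    · rcases h with (h | h) | h
      exacts [(hAC.ne_of_mem h h' rfl).elim, (hBC.ne_of_mem h h' rfl).elim,
        (hCD.ne_of_mem h' h rfl).elim]
    · exact hv
  have haX : a ∈ X := .inl ⟨.inl (.inl ha), ⟨a, .inl (.inl ha)⟩, ha, rfl⟩
  have hbX : b ∉ X := fun h => C1.notMem_colors_of_forall_adj (fun a ha => hAB a ha b hb)
    ((hX₁ b (.inl (.inr hb))).1 h)
  have hcol : (G.induce X).Colorable F₁.ncard := by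
    refine colorable_induce_of_minimallyImperfect hmi
      ((Set.ne_univ_iff_exists_notMem X).2 ⟨b, hbX⟩) ?_
    intro s hsX hs
    rcases hs.subset_or_subset_of_forall_not_adj hcover hCD hnadj with h | h
    · exact hs.card_le_ncard_of_coloring_induce C1 h fun x hx => (hX₁ x (h hx)).1 (hsX hx)
    · rw [heq]
      exact hs.card_le_ncard_of_coloring_induce C2 h fun x hx => (hX₂ x (h hx)).1 (hsX hx)
  have hcol' : (G.induce Xᶜ).Colorable (F₁ᶜ).ncard := by
    refine colorable_induce_of_minimallyImperfect hmi
      ((Set.ne_univ_iff_exists_notMem Xᶜ).2 ⟨a, fun h => h haX⟩) ?_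
    intro s hsX hs
    rcases hs.subset_or_subset_of_forall_not_adj hcover hCD hnadj with h | h
    · exact hs.card_le_ncard_of_coloring_induce C1 h
        fun x hx hc => hsX hx ((hX₁ x (h hx)).2 hc)
    · rw [Set.ncard_compl, heq, ← Set.ncard_compl F₂]
      exact hs.card_le_ncard_of_coloring_induce C2 h
        fun x hx hc => hsX hx ((hX₂ x (h hx)).2 hc)
  refine not_colorable_cliqueNum_of_minimallyImperfect hmi ?_
  have := hcol.of_induce_compl hcol'
  rwa [Set.ncard_add_ncard_compl, Nat.card_fin] at this
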